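/- arXiv:1609.01938 — 4 statements merged into one kernel-verified Lean document; each statement's English description precedes it below -/
import Mathlib

section
/- Let d ≥ 3 be an integer and c > 0. Then there exists a constant C > 0 (depending only on d and c) such that for all t > 0 and all x ∈ ℝ^d \ {0}, ∫_{ℝ^d} t^{−d/2} e^{−|x−z|²/(ct)} |z|^{−2} dz ≤ C |x|^{−2}. -/
open MeasureTheory Metric Real
open scoped ENNReal

/-- The singularity `‖z‖ ^ (-2)` has integral `O(R ^ (d - 2))` on the ball of radius `R`. -/
theorem lintegral_indicator_norm_rpow_neg_two_le (d : ℕ) (hd : 3 ≤ d) (R : ℝ) (hR : 0 < R) :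
    ∫⁻ z : EuclideanSpace ℝ (Fin d),
        ENNReal.ofReal ((Set.Iio R).indicator (fun y : ℝ => y ^ (-2 : ℝ)) ‖z‖) ≤
      ENNReal.ofReal
        (d * volume.real (ball (0 : EuclideanSpace ℝ (Fin d)) 1) * R ^ (d - 2)) := by
  have : Nonempty (Fin d) := ⟨⟨0, by omega⟩⟩
  set H : ℝ → ℝ := (Set.Iio R).indicator (fun y : ℝ => y ^ (-2 : ℝ)) with hH
  have hHm : Measurable H := (measurable_id.pow_const _).indicator measurableSet_Iio
  have hH0 : ∀ y, 0 ≤ y → 0 ≤ H y := fun y hy =>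
    Set.indicator_apply_nonneg fun _ => rpow_nonneg hy _
  have hbound : ∀ y ∈ Set.Ioi (0 : ℝ),
      y ^ (d - 1) * H y ≤ (Set.Iio R).indicator (fun _ => R ^ (d - 3)) y := by
    intro y (hy : 0 < y)
    by_cases hyR : y < R
    · simp only [hH, Set.indicator_of_mem (show y ∈ Set.Iio R from hyR)]
      have h1 : y ^ (d - 1) * y ^ (-2 : ℝ) = y ^ (d - 3) := by
        rw [show d - 1 = (d - 3) + 2 by omega, pow_add, rpow_neg hy.le, rpow_two, mul_assoc,
          mul_inv_cancel₀ (by positivity), mul_one]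
      rw [h1]
      exact pow_le_pow_left₀ hy.le hyR.le _
    · simp [hH, hyR]
  have hset : (volume.restrict (Set.Ioi (0 : ℝ))).restrict (Set.Iio R)
      = volume.restrict (Set.Ioo 0 R) := by
    rw [Measure.restrict_restrict measurableSet_Iio, Set.inter_comm, Set.Ioi_inter_Iio]
  have hintB : Integrable ((Set.Iio R).indicator (fun _ : ℝ => R ^ (d - 3)))
      (volume.restrict (Set.Ioi (0 : ℝ))) := by
    rw [integrable_indicator_iff measurableSet_Iio, IntegrableOn, hset]
    exact integrable_const _
  have hint : IntegrableOn (fun y : ℝ => y ^ (d - 1) • H y) (Set.Ioi 0) := by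
    refine Integrable.mono' hintB (by fun_prop) ?_
    filter_upwards [ae_restrict_mem measurableSet_Ioi] with y hy
    have hy0 : (0 : ℝ) < y := hy
    rw [smul_eq_mul, norm_of_nonneg (mul_nonneg (by positivity) (hH0 y hy0.le))]
    exact hbound y hy
  have hintE : Integrable (fun z : EuclideanSpace ℝ (Fin d) => H ‖z‖) := by
    rw [integrable_fun_norm_addHaar volume (f := H), finrank_euclideanSpace_fin]
    exact hint
  rw [← ofReal_integral_eq_lintegral_ofReal hintE
    (Filter.Eventually.of_forall fun z => hH0 _ (norm_nonneg z))]
  refine ENNReal.ofReal_le_ofReal ?_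
  rw [integral_fun_norm_addHaar volume H, finrank_euclideanSpace_fin, nsmul_eq_mul, smul_eq_mul,
    mul_assoc]
  have hI : ∫ y in Set.Ioi (0 : ℝ), y ^ (d - 1) • H y ≤ R ^ (d - 2) := by
    calc ∫ y in Set.Ioi (0 : ℝ), y ^ (d - 1) • H y
        ≤ ∫ y in Set.Ioi (0 : ℝ), (Set.Iio R).indicator (fun _ => R ^ (d - 3)) y :=
          setIntegral_mono_on hint hintB measurableSet_Ioi hbound
      _ = R ^ (d - 2) := by
          rw [integral_indicator measurableSet_Iio, hset, setIntegral_const]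
          simp only [volume_real_Ioo_of_le hR.le, smul_eq_mul, sub_zero]
          rw [show d - 2 = (d - 3) + 1 by omega, pow_succ']
  gcongr

/-- Off the diagonal the heat kernel is bounded by a power of the distance, uniformly in time. -/
theorem rpow_neg_mul_exp_neg_le {a c t r : ℝ} (ha : 0 < a) (hc : 0 < c) (ht : 0 < t)
    (hr : 0 < r) :
    t ^ (-a) * exp (-(r / 2) ^ 2 / (c * t)) ≤ (4 * c * a) ^ a * r ^ (-(2 * a)) := by
  set s := (r / 2) ^ 2 / (c * t) with hs
  have h1 : t⁻¹ * exp (-(s / a)) ≤ 4 * c * a * (r ^ 2)⁻¹ := by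
    have h2 : s / a ≤ exp (s / a) := by linarith [add_one_le_exp (s / a)]
    have h3 : t⁻¹ = 4 * c * a * (r ^ 2)⁻¹ * (s / a) := by
      rw [hs]; field_simp; norm_num
    rw [h3, exp_neg, mul_assoc]
    refine mul_le_of_le_one_right (by positivity) ?_
    rw [← div_eq_mul_inv]
    exact (div_le_one (exp_pos _)).2 h2
  have h4 := rpow_le_rpow (by positivity) h1 ha.le
  rw [mul_rpow (by positivity) (by positivity), mul_rpow (by positivity) (by positivity),
    ← exp_mul, inv_rpow ht.le, ← rpow_neg ht.le, inv_rpow (by positivity), ← rpow_two,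
    ← rpow_mul hr.le, ← rpow_neg hr.le] at h4
  rw [neg_div, ← hs]
  rwa [show -(s / a) * a = -s by field_simp] at h4

/-- The total mass of the Gaussian `t ^ (-d / 2) * exp (-‖x - z‖ ^ 2 / (c * t))`. -/
theorem lintegral_gaussian_kernel (d : ℕ) {c t : ℝ} (hc : 0 < c) (ht : 0 < t)
    (x : EuclideanSpace ℝ (Fin d)) :
    ∫⁻ z, ENNReal.ofReal (t ^ (-(d : ℝ) / 2) * exp (-‖x - z‖ ^ 2 / (c * t))) =
      ENNReal.ofReal ((π * c) ^ ((d : ℝ) / 2)) := by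
  have hb : 0 < (c * t)⁻¹ := by positivity
  have h := GaussianFourier.integral_rexp_neg_mul_sq_norm
    (V := EuclideanSpace ℝ (Fin d)) hb
  rw [finrank_euclideanSpace_fin] at h
  have hint : Integrable (fun v : EuclideanSpace ℝ (Fin d) => exp (-(c * t)⁻¹ * ‖v‖ ^ 2)) :=
    Integrable.of_integral_ne_zero (by rw [h]; positivity)
  have hshift := lintegral_sub_left_eq_self (μ := volume)
    (fun v : EuclideanSpace ℝ (Fin d) =>
      ENNReal.ofReal (t ^ (-(d : ℝ) / 2) * exp (-‖v‖ ^ 2 / (c * t)))) x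
  rw [hshift]
  have heq : ∀ v : EuclideanSpace ℝ (Fin d),
      -‖v‖ ^ 2 / (c * t) = -(c * t)⁻¹ * ‖v‖ ^ 2 := fun v => by
    rw [div_eq_mul_inv]; ring
  simp only [heq]
  rw [← ofReal_integral_eq_lintegral_ofReal (hint.const_mul _)
    (Filter.Eventually.of_forall fun z => by positivity), integral_const_mul, h]
  congr 1
  rw [div_inv_eq_mul, ← mul_assoc, mul_rpow (by positivity) ht.le, neg_div, mul_left_comm,
    ← rpow_add ht, neg_add_cancel, rpow_zero, mul_one]

theorem stmt4 (d : ℕ) (hd : 3 ≤ d) (c : ℝ) (hc : 0 < c) :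
    ∃ C : ℝ, 0 < C ∧ ∀ t : ℝ, 0 < t → ∀ x : EuclideanSpace ℝ (Fin d), x ≠ 0 →
      ∫⁻ z, ENNReal.ofReal
          (t ^ (-(d : ℝ) / 2) * Real.exp (-‖x - z‖ ^ 2 / (c * t)) * ‖z‖ ^ (-2 : ℝ)) ≤
        ENNReal.ofReal (C * ‖x‖ ^ (-2 : ℝ)) := by
  have hd0 : (0 : ℝ) < d := by exact_mod_cast (by omega : 0 < d)
  set a : ℝ := (d : ℝ) / 2 with ha
  have ha0 : 0 < a := by positivity
  set V : ℝ := volume.real (ball (0 : EuclideanSpace ℝ (Fin d)) 1)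
  have hV : 0 ≤ V := measureReal_nonneg
  set K : ℝ := (4 * c * a) ^ a
  have hK : 0 ≤ K := by positivity
  refine ⟨4 * (π * c) ^ a + K * (d * V), by positivity, fun t ht x hx => ?_⟩
  set r := ‖x‖
  have hr : 0 < r := norm_pos_iff.2 hx
  set G : EuclideanSpace ℝ (Fin d) → ℝ :=
    fun z => t ^ (-(d : ℝ) / 2) * exp (-‖x - z‖ ^ 2 / (c * t)) with hG
  have hG0 : ∀ z, 0 ≤ G z := fun z => by positivity
  set H : ℝ → ℝ := (Set.Iio (r / 2)).indicator (fun y : ℝ => y ^ (-2 : ℝ)) with hH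
  have hH0 : ∀ y, 0 ≤ y → 0 ≤ H y := fun y hy =>
    Set.indicator_apply_nonneg fun _ => rpow_nonneg hy _
  have hHm : Measurable H := (measurable_id.pow_const _).indicator measurableSet_Iio
  have hpt : ∀ z, G z * ‖z‖ ^ (-2 : ℝ) ≤
      4 * r ^ (-2 : ℝ) * G z + K * r ^ (-(2 * a)) * H ‖z‖ := by
    intro z
    have hz0 : 0 ≤ ‖z‖ ^ (-2 : ℝ) := rpow_nonneg (norm_nonneg z) _
    by_cases hz : ‖z‖ < r / 2
    · have hdist : r / 2 ≤ ‖x - z‖ := by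
        have := norm_sub_norm_le x z
        change r - ‖z‖ ≤ _ at this
        linarith
      have hGz : G z ≤ K * r ^ (-(2 * a)) := by
        refine le_trans ?_ (rpow_neg_mul_exp_neg_le ha0 hc ht hr)
        simp only [hG, neg_div]
        gcongr
      rw [hH, Set.indicator_of_mem (show ‖z‖ ∈ Set.Iio (r / 2) from hz)]
      have h1 : 0 ≤ 4 * r ^ (-2 : ℝ) * G z := mul_nonneg (by positivity) (hG0 z)
      have h2 := mul_le_mul_of_nonneg_right hGz hz0
      linarith
    · have hle : ‖z‖ ^ (-2 : ℝ) ≤ 4 * r ^ (-2 : ℝ) := by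
        calc ‖z‖ ^ (-2 : ℝ) ≤ (r / 2) ^ (-2 : ℝ) :=
              rpow_le_rpow_of_nonpos (by positivity) (not_lt.1 hz) (by norm_num)
          _ = 4 * r ^ (-2 : ℝ) := by
              rw [rpow_neg (by positivity), rpow_neg hr.le, rpow_two, rpow_two]
              field_simp
              norm_num
      have h1 : 0 ≤ K * r ^ (-(2 * a)) * H ‖z‖ :=
        mul_nonneg (by positivity) (hH0 _ (norm_nonneg z))
      have h2 := mul_le_mul_of_nonneg_left hle (hG0 z)
      linarith
  have hGm : Measurable G := by fun_prop
  have hp1 : 0 ≤ 4 * r ^ (-2 : ℝ) := by positivity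
  have hp2 : 0 ≤ K * r ^ (-(2 * a)) := by positivity
  calc ∫⁻ z, ENNReal.ofReal (G z * ‖z‖ ^ (-2 : ℝ))
      ≤ ∫⁻ z, (ENNReal.ofReal (4 * r ^ (-2 : ℝ)) * ENNReal.ofReal (G z) +
          ENNReal.ofReal (K * r ^ (-(2 * a))) * ENNReal.ofReal (H ‖z‖)) := by
        refine lintegral_mono fun z => ?_
        rw [← ENNReal.ofReal_mul hp1, ← ENNReal.ofReal_mul hp2,
          ← ENNReal.ofReal_add (mul_nonneg hp1 (hG0 z))
            (mul_nonneg hp2 (hH0 _ (norm_nonneg z)))]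
        exact ENNReal.ofReal_le_ofReal (hpt z)
    _ = ENNReal.ofReal (4 * r ^ (-2 : ℝ)) * ENNReal.ofReal ((π * c) ^ a) +
          ENNReal.ofReal (K * r ^ (-(2 * a))) * ∫⁻ z : EuclideanSpace ℝ (Fin d),
            ENNReal.ofReal (H ‖z‖) := by
        rw [lintegral_add_left (by fun_prop), lintegral_const_mul _ (by fun_prop),
          lintegral_const_mul _ (by fun_prop), lintegral_gaussian_kernel d hc ht x]
    _ ≤ ENNReal.ofReal (4 * r ^ (-2 : ℝ)) * ENNReal.ofReal ((π * c) ^ a) +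
          ENNReal.ofReal (K * r ^ (-(2 * a))) * ENNReal.ofReal (d * V * (r / 2) ^ (d - 2)) := by
        gcongr
        exact lintegral_indicator_norm_rpow_neg_two_le d hd (r / 2) (by positivity)
    _ ≤ ENNReal.ofReal ((4 * (π * c) ^ a + K * (d * V)) * r ^ (-2 : ℝ)) := by
        rw [← ENNReal.ofReal_mul hp1, ← ENNReal.ofReal_mul hp2,
          ← ENNReal.ofReal_add (by positivity) (by positivity)]
        refine ENNReal.ofReal_le_ofReal ?_
        have h1 : (r / 2) ^ (d - 2) ≤ r ^ (d - 2) :=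
          pow_le_pow_left₀ (by positivity) (by linarith) _
        have h2 : r ^ (-(2 * a)) * r ^ (d - 2) = r ^ (-2 : ℝ) := by
          rw [← rpow_natCast, ← rpow_add hr, Nat.cast_sub (by omega), ha]
          congr 1
          push_cast
          ring
        calc 4 * r ^ (-2 : ℝ) * (π * c) ^ a + K * r ^ (-(2 * a)) * (d * V * (r / 2) ^ (d - 2))
            ≤ 4 * r ^ (-2 : ℝ) * (π * c) ^ a + K * r ^ (-(2 * a)) * (d * V * r ^ (d - 2)) := by
              gcongr
          _ = 4 * r ^ (-2 : ℝ) * (π * c) ^ a + K * (d * V) * (r ^ (-(2 * a)) * r ^ (d - 2)) := by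
              ring
          _ = _ := by rw [h2]; ring
end

section
/- Let d ≥ 3 be an integer, c > 0 and σ ≥ 0 with σ + 2 < d. Then there exists a constant C > 0 (depending only on d, c, σ) such that for all 0 < s ≤ t and all x ∈ ℝ^d \ {0}, ∫_{ℝ^d} t^{−d/2} e^{−|x−z|²/(ct)} |z|^{−2} (1 + √s/|z|)^σ dz ≤ C |x|^{−2}. -/
open MeasureTheory Metric Real
open scoped ENNReal

lemma integrable_exp_neg_norm_sq_div {d : ℕ} {c : ℝ} (hc : 0 < c) :
    Integrable (fun v : EuclideanSpace ℝ (Fin d) => Real.exp (-‖v‖ ^ 2 / c)) := by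
  have h := (GaussianFourier.integrable_cexp_neg_mul_sq_norm_add (b := ((1 / c : ℝ) : ℂ))
    (by rw [Complex.ofReal_re]; positivity) 0 (0 : EuclideanSpace ℝ (Fin d))).norm
  refine h.congr (Filter.Eventually.of_forall fun v => ?_)
  simp only [Complex.norm_exp]
  congr 1
  have : (-((1 / c : ℝ) : ℂ) * (‖v‖ : ℂ) ^ 2 + 0 * ((inner ℝ (0 : EuclideanSpace ℝ (Fin d)) v : ℝ) : ℂ))
      = ((-‖v‖ ^ 2 / c : ℝ) : ℂ) := by
    push_cast
    ring
  rw [this, Complex.ofReal_re]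

lemma lintegral_comp_smul_euclideanSpace {d : ℕ} {r : ℝ} (hr : 0 < r)
    (f : EuclideanSpace ℝ (Fin d) → ℝ≥0∞) :
    ∫⁻ w, f (r • w) = ENNReal.ofReal ((r ^ d)⁻¹) * ∫⁻ z, f z := by
  have hemb : MeasurableEmbedding (fun w : EuclideanSpace ℝ (Fin d) => r • w) :=
    (Homeomorph.smulOfNeZero r hr.ne').measurableEmbedding
  rw [← hemb.lintegral_map, Measure.map_addHaar_smul _ hr.ne', lintegral_smul_measure,
    finrank_euclideanSpace_fin, abs_of_pos (by positivity), smul_eq_mul]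

lemma one_add_sq_mul_exp_le {c : ℝ} (hc : 0 < c) (a : ℝ) :
    (1 + a ^ 2) * Real.exp (-a ^ 2 / c) ≤ (1 + 2 * c) * Real.exp (-a ^ 2 / (2 * c)) := by
  have hsplit : Real.exp (-a ^ 2 / c) =
      Real.exp (-a ^ 2 / (2 * c)) * Real.exp (-a ^ 2 / (2 * c)) := by
    rw [← Real.exp_add]
    congr 1
    field_simp
    ring
  have hinv : Real.exp (a ^ 2 / (2 * c)) * Real.exp (-a ^ 2 / (2 * c)) = 1 := by
    rw [← Real.exp_add, neg_div, add_neg_cancel, Real.exp_zero]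
  have hone : 1 + a ^ 2 ≤ (1 + 2 * c) * Real.exp (a ^ 2 / (2 * c)) := by
    have h1 := Real.add_one_le_exp (a ^ 2 / (2 * c))
    have h2 : 1 + a ^ 2 ≤ (1 + 2 * c) * (a ^ 2 / (2 * c) + 1) := by
      have h3 : (1 + 2 * c) * (a ^ 2 / (2 * c) + 1) = a ^ 2 / (2 * c) + 1 + a ^ 2 + 2 * c := by
        field_simp
        ring
      have : 0 ≤ a ^ 2 / (2 * c) := by positivity
      linarith
    exact h2.trans (by gcongr)
  rw [hsplit]
  calc (1 + a ^ 2) * (Real.exp (-a ^ 2 / (2 * c)) * Real.exp (-a ^ 2 / (2 * c)))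
      ≤ ((1 + 2 * c) * Real.exp (a ^ 2 / (2 * c))) *
        (Real.exp (-a ^ 2 / (2 * c)) * Real.exp (-a ^ 2 / (2 * c))) := by gcongr
    _ = (1 + 2 * c) * Real.exp (-a ^ 2 / (2 * c)) *
        (Real.exp (a ^ 2 / (2 * c)) * Real.exp (-a ^ 2 / (2 * c))) := by ring
    _ = _ := by rw [hinv, mul_one]

lemma gaussian_mul_singular_le {c σ a b n : ℝ} (hc : 0 < c) (hσ : 0 ≤ σ)
    (hb : 0 < b) (hn : 0 < n) (hab : n ≤ a + b) :
    Real.exp (-a ^ 2 / c) * b ^ (-2 : ℝ) * (1 + 1 / b) ^ σ ≤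
      2 * (1 + 2 * c) * 2 ^ σ * n ^ (-2 : ℝ) *
        (Real.exp (-a ^ 2 / (2 * c)) + if b < 1 then b ^ (-(2 + σ)) else 0) := by
  have hE := one_add_sq_mul_exp_le hc a
  have hg1 : Real.exp (-a ^ 2 / (2 * c)) ≤ 1 := by
    rw [Real.exp_le_one_iff, neg_div]
    have : 0 ≤ a ^ 2 / (2 * c) := by positivity
    linarith
  have hnsq : n ^ 2 ≤ 2 * (a ^ 2 + b ^ 2) := by nlinarith [sq_nonneg (a - b)]
  have key : n ^ 2 * (Real.exp (-a ^ 2 / c) * b ^ (-2 : ℝ) * (1 + 1 / b) ^ σ) ≤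
      2 * (1 + 2 * c) * 2 ^ σ *
        (Real.exp (-a ^ 2 / (2 * c)) + if b < 1 then b ^ (-(2 + σ)) else 0) := by
    split_ifs with hb1
    · have hJ : (1 + 1 / b) ^ σ ≤ 2 ^ σ * b ^ (-σ) := by
        rw [Real.rpow_neg hb.le, ← div_eq_mul_inv, ← Real.div_rpow zero_le_two hb.le]
        refine Real.rpow_le_rpow (by positivity) ?_ hσ
        rw [le_div_iff₀ hb, add_mul, one_div_mul_cancel hb.ne']
        linarith
      have hb2 : b ^ 2 ≤ 1 := by nlinarith
      calc n ^ 2 * (Real.exp (-a ^ 2 / c) * b ^ (-2 : ℝ) * (1 + 1 / b) ^ σ)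
          ≤ (2 * (1 + a ^ 2)) *
            (Real.exp (-a ^ 2 / c) * b ^ (-2 : ℝ) * (2 ^ σ * b ^ (-σ))) := by
            gcongr
            linarith
        _ = 2 * 2 ^ σ * ((1 + a ^ 2) * Real.exp (-a ^ 2 / c)) * b ^ (-(2 + σ)) := by
            rw [neg_add, Real.rpow_add hb]
            ring
        _ ≤ 2 * 2 ^ σ * ((1 + 2 * c) * 1) * b ^ (-(2 + σ)) := by
            gcongr 2 * 2 ^ σ * ?_ * _
            exact hE.trans (by gcongr)
        _ = 2 * (1 + 2 * c) * 2 ^ σ * (0 + b ^ (-(2 + σ))) := by ring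
        _ ≤ _ := by
            gcongr
            positivity
    · rw [not_lt] at hb1
      have hJ : (1 + 1 / b) ^ σ ≤ 2 ^ σ := by
        refine Real.rpow_le_rpow (by positivity) ?_ hσ
        have : 1 / b ≤ 1 := by rw [div_le_one hb]; exact hb1
        linarith
      have hn2 : n ^ 2 * b ^ (-2 : ℝ) ≤ 2 * (1 + a ^ 2) := by
        rw [Real.rpow_neg hb.le, Real.rpow_two, ← div_eq_mul_inv, div_le_iff₀ (by positivity)]
        nlinarith [mul_nonneg (sq_nonneg a) (by nlinarith : (0 : ℝ) ≤ b ^ 2 - 1)]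
      calc n ^ 2 * (Real.exp (-a ^ 2 / c) * b ^ (-2 : ℝ) * (1 + 1 / b) ^ σ)
          = (n ^ 2 * b ^ (-2 : ℝ)) * Real.exp (-a ^ 2 / c) * (1 + 1 / b) ^ σ := by ring
        _ ≤ (2 * (1 + a ^ 2)) * Real.exp (-a ^ 2 / c) * 2 ^ σ := by gcongr
        _ = 2 * 2 ^ σ * ((1 + a ^ 2) * Real.exp (-a ^ 2 / c)) := by ring
        _ ≤ 2 * 2 ^ σ * ((1 + 2 * c) * Real.exp (-a ^ 2 / (2 * c))) := by gcongr
        _ = _ := by ring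
  rw [Real.rpow_neg hn.le, Real.rpow_two]
  rw [mul_comm (n ^ 2), ← le_div_iff₀ (by positivity)] at key
  exact key.trans_eq (by ring)

lemma integrable_norm_rpow_unit_ball {d : ℕ} {α : ℝ} (hd : 1 ≤ d) (hα : α < d) :
    Integrable (fun w : EuclideanSpace ℝ (Fin d) => if ‖w‖ < 1 then ‖w‖ ^ (-α) else 0) := by
  have h : IntegrableOn (fun w : EuclideanSpace ℝ (Fin d) => ‖w‖ ^ (-α)) (ball 0 1) := by
    refine integrableOn_ball_of_norm_le_rpow (C := 1) (α := α) ?_ ?_ ?_ ?_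
    · simpa using hd
    · simpa using hα
    · refine Filter.Eventually.of_forall fun x => ?_
      rw [one_mul, Real.norm_of_nonneg (by positivity)]
    · exact (measurable_norm.pow_const _).aestronglyMeasurable
  refine ((integrable_indicator_iff measurableSet_ball).2 h).congr
    (Filter.Eventually.of_forall fun w => ?_)
  by_cases hw : ‖w‖ < 1 <;> simp [hw]

theorem stmt5 (d : ℕ) (hd : 3 ≤ d) (c σ : ℝ) (hc : 0 < c) (hσ : 0 ≤ σ)
    (hσd : σ + 2 < d) :
    ∃ C : ℝ, 0 < C ∧ ∀ s t : ℝ, 0 < s → s ≤ t →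
      ∀ x : EuclideanSpace ℝ (Fin d), x ≠ 0 →
      ∫⁻ z, ENNReal.ofReal
          (t ^ (-(d : ℝ) / 2) * Real.exp (-‖x - z‖ ^ 2 / (c * t)) * ‖z‖ ^ (-2 : ℝ) *
            (1 + Real.sqrt s / ‖z‖) ^ σ) ≤
        ENNReal.ofReal (C * ‖x‖ ^ (-2 : ℝ)) := by
  set G : EuclideanSpace ℝ (Fin d) → ℝ := fun v => Real.exp (-‖v‖ ^ 2 / (2 * c)) with hG
  set H : EuclideanSpace ℝ (Fin d) → ℝ :=
    fun w => if ‖w‖ < 1 then ‖w‖ ^ (-(2 + σ)) else 0 with hH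
  have hGint : Integrable G := integrable_exp_neg_norm_sq_div (by positivity)
  have hHint : Integrable H := integrable_norm_rpow_unit_ball (by omega) (by linarith)
  have hG0 : ∀ v, 0 ≤ G v := fun v => (Real.exp_pos _).le
  have hH0 : ∀ v, 0 ≤ H v := fun v => by
    simp only [hH]
    split_ifs <;> positivity
  set K : ℝ := 2 * (1 + 2 * c) * 2 ^ σ with hK
  have hKpos : 0 < K := by positivity
  have hI : 0 ≤ (∫ v, G v) + ∫ w, H w :=
    add_nonneg (integral_nonneg hG0) (integral_nonneg hH0)
  refine ⟨K * ((∫ v, G v) + (∫ w, H w) + 1), by positivity, ?_⟩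
  intro s t hs hst x hx
  have ht : 0 < t := hs.trans_le hst
  set r := Real.sqrt t with hr_def
  have hr : 0 < r := Real.sqrt_pos.2 ht
  have hrt : r ^ 2 = t := Real.sq_sqrt ht.le
  have htd : t ^ (-(d : ℝ) / 2) = (r ^ d)⁻¹ := by
    rw [hr_def, Real.sqrt_eq_rpow, ← Real.rpow_natCast, ← Real.rpow_mul ht.le, ← Real.rpow_neg ht.le]
    congr 1
    ring
  obtain ⟨y, rfl⟩ : ∃ y, x = r • y := ⟨r⁻¹ • x, (smul_inv_smul₀ hr.ne' x).symm⟩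
  have hy : 0 < ‖y‖ := norm_pos_iff.2 fun h => hx (by rw [h, smul_zero])
  have hnorm : ∀ v : EuclideanSpace ℝ (Fin d), ‖r • v‖ = r * ‖v‖ := fun v => by
    rw [norm_smul, Real.norm_of_nonneg hr.le]
  have hpt : ∀ w : EuclideanSpace ℝ (Fin d),
      Real.exp (-‖r • y - r • w‖ ^ 2 / (c * t)) * ‖r • w‖ ^ (-2 : ℝ) *
        (1 + Real.sqrt s / ‖r • w‖) ^ σ ≤ K * ‖r • y‖ ^ (-2 : ℝ) * (G (y - w) + H w) := by
    intro w
    rcases eq_or_ne w 0 with rfl | hw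
    · rw [smul_zero, norm_zero, Real.zero_rpow (by norm_num), mul_zero, zero_mul]
      have := hG0 (y - 0)
      have := hH0 0
      positivity
    have hw : 0 < ‖w‖ := norm_pos_iff.2 hw
    have hexp : -‖r • y - r • w‖ ^ 2 / (c * t) = -‖y - w‖ ^ 2 / c := by
      rw [← smul_sub, hnorm, mul_pow, hrt]
      field_simp
    have hfrac : Real.sqrt s / (r * ‖w‖) ≤ 1 / ‖w‖ := by
      rw [div_le_div_iff₀ (by positivity) hw, one_mul]
      gcongr
      exact Real.sqrt_le_sqrt hst
    rw [hexp, hnorm, hnorm, Real.mul_rpow hr.le hw.le, Real.mul_rpow hr.le hy.le]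
    have hbase := gaussian_mul_singular_le (a := ‖y - w‖) hc hσ hw hy
      (by simpa using norm_add_le (y - w) w)
    calc Real.exp (-‖y - w‖ ^ 2 / c) * (r ^ (-2 : ℝ) * ‖w‖ ^ (-2 : ℝ)) *
          (1 + Real.sqrt s / (r * ‖w‖)) ^ σ
        ≤ Real.exp (-‖y - w‖ ^ 2 / c) * (r ^ (-2 : ℝ) * ‖w‖ ^ (-2 : ℝ)) *
          (1 + 1 / ‖w‖) ^ σ := by gcongr
      _ = r ^ (-2 : ℝ) *
          (Real.exp (-‖y - w‖ ^ 2 / c) * ‖w‖ ^ (-2 : ℝ) * (1 + 1 / ‖w‖) ^ σ) := by ring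
      _ ≤ r ^ (-2 : ℝ) * (K * ‖y‖ ^ (-2 : ℝ) * (G (y - w) + H w)) := by gcongr
      _ = _ := by ring
  have hGy : Integrable fun w => G (y - w) := hGint.comp_sub_left y
  calc ∫⁻ z, ENNReal.ofReal
          (t ^ (-(d : ℝ) / 2) * Real.exp (-‖r • y - z‖ ^ 2 / (c * t)) * ‖z‖ ^ (-2 : ℝ) *
            (1 + Real.sqrt s / ‖z‖) ^ σ)
      = ENNReal.ofReal ((r ^ d)⁻¹) * ∫⁻ z, ENNReal.ofReal
          (Real.exp (-‖r • y - z‖ ^ 2 / (c * t)) * ‖z‖ ^ (-2 : ℝ) *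
            (1 + Real.sqrt s / ‖z‖) ^ σ) := by
        rw [← lintegral_const_mul' _ _ ENNReal.ofReal_ne_top]
        refine lintegral_congr fun z => ?_
        rw [← ENNReal.ofReal_mul (by positivity), htd]
        congr 1
        ring
    _ = ∫⁻ w, ENNReal.ofReal
          (Real.exp (-‖r • y - r • w‖ ^ 2 / (c * t)) * ‖r • w‖ ^ (-2 : ℝ) *
            (1 + Real.sqrt s / ‖r • w‖) ^ σ) :=
        (lintegral_comp_smul_euclideanSpace hr _).symm
    _ ≤ ∫⁻ w, ENNReal.ofReal (K * ‖r • y‖ ^ (-2 : ℝ) * (G (y - w) + H w)) :=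
        lintegral_mono fun w => ENNReal.ofReal_le_ofReal (hpt w)
    _ = ENNReal.ofReal (∫ w, K * ‖r • y‖ ^ (-2 : ℝ) * (G (y - w) + H w)) := by
        refine (ofReal_integral_eq_lintegral_ofReal ((hGy.add hHint).const_mul _) ?_).symm
        exact Filter.Eventually.of_forall fun w =>
          mul_nonneg (by positivity) (add_nonneg (hG0 (y - w)) (hH0 w))
    _ ≤ _ := by
        refine ENNReal.ofReal_le_ofReal ?_
        rw [integral_const_mul, integral_add hGy hHint, integral_sub_left_eq_self G volume y]
        have : 0 ≤ K * ‖r • y‖ ^ (-2 : ℝ) := by positivity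
        nlinarith
end

section
/- Let d ≥ 3 be an integer and 0 < ε < 1. For x ∈ ℝ^d let ψ_ε(x) = ∫_0^{|x|} s^ε/(1+s^ε) ds. Then for every x ∈ ℝ^d \ {0}, −(1/2) Δ²ψ_ε(x) ≥ (1/|x|³) · (|x|^ε/(1+|x|^ε)) · ((d−1)(d−3)/2 − 3d²ε), where Δ² denotes the bilaplacian (the Laplacian applied twice). -/
open MeasureTheory Metric Real

/-- The Laplacian `Δf = ∑ⱼ ∂ⱼ² f` of a function on `ℝ^d`. -/
noncomputable def lap {d : ℕ} (f : EuclideanSpace ℝ (Fin d) → ℝ)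
    (x : EuclideanSpace ℝ (Fin d)) : ℝ :=
  ∑ j : Fin d,
    fderiv ℝ (fun y => fderiv ℝ f y (EuclideanSpace.single j 1)) x
      (EuclideanSpace.single j 1)

/-- The radial weight `ψ_ε(x) = ∫_0^{|x|} s^ε/(1+s^ε) ds`. -/
noncomputable def psiEps (d : ℕ) (ε : ℝ) (x : EuclideanSpace ℝ (Fin d)) : ℝ :=
  ∫ s in (0 : ℝ)..‖x‖, s ^ ε / (1 + s ^ ε)

/-- The Laplacian of a function which is radial away from the origin. -/
theorem lap_radial {d : ℕ} {f : EuclideanSpace ℝ (Fin d) → ℝ} {F F' F'' : ℝ → ℝ}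
    (hf : ∀ y, y ≠ 0 → f y = F ‖y‖)
    (hF : ∀ r, 0 < r → HasDerivAt F (F' r) r)
    (hF' : ∀ r, 0 < r → HasDerivAt F' (F'' r) r)
    {x : EuclideanSpace ℝ (Fin d)} (hx : x ≠ 0) :
    lap f x = F'' ‖x‖ + ((d : ℝ) - 1) / ‖x‖ * F' ‖x‖ := by
  have hnorm : ∀ y : EuclideanSpace ℝ (Fin d), y ≠ 0 →
      HasFDerivAt (fun z : EuclideanSpace ℝ (Fin d) => ‖z‖) (‖y‖⁻¹ • innerSL ℝ y) y := by
    intro y hy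
    have h := (hasStrictFDerivAt_norm_sq y).hasFDerivAt.sqrt
      (pow_ne_zero 2 (norm_ne_zero_iff.mpr hy))
    simp only [Real.sqrt_sq (norm_nonneg _)] at h
    refine h.congr_fderiv ?_
    ext z
    simp
    field_simp
  have hne : ∀ᶠ y in nhds x, y ≠ 0 := isOpen_ne.mem_nhds hx
  have hx0 : 0 < ‖x‖ := norm_pos_iff.mpr hx
  have hfirst : ∀ j : Fin d, ∀ y, y ≠ 0 →
      fderiv ℝ f y (EuclideanSpace.single j 1) = F' ‖y‖ / ‖y‖ * y j := by
    intro j y hy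
    have heq : f =ᶠ[nhds y] fun z => F ‖z‖ := by
      filter_upwards [isOpen_ne.mem_nhds hy] with z hz using hf z hz
    rw [heq.fderiv_eq]
    refine (congrArg (fun L => L (EuclideanSpace.single j 1))
      ((hF _ (norm_pos_iff.mpr hy)).comp_hasFDerivAt y (hnorm y hy)).fderiv).trans ?_
    simp [EuclideanSpace.inner_single_right]
    ring
  have hsecond : ∀ j : Fin d,
      fderiv ℝ (fun y => fderiv ℝ f y (EuclideanSpace.single j 1)) x
        (EuclideanSpace.single j 1) =
      F' ‖x‖ / ‖x‖ + (F'' ‖x‖ * ‖x‖ - F' ‖x‖) / ‖x‖ ^ 3 * (x j) ^ 2 := by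
    intro j
    have heq : (fun y => fderiv ℝ f y (EuclideanSpace.single j 1)) =ᶠ[nhds x]
        fun y => F' ‖y‖ / ‖y‖ * y j := by
      filter_upwards [hne] with z hz using hfirst j z hz
    have hK : HasDerivAt (fun r => F' r / r) ((F'' ‖x‖ * ‖x‖ - F' ‖x‖ * 1) / ‖x‖ ^ 2) ‖x‖ :=
      (hF' _ hx0).div (hasDerivAt_id _) hx0.ne'
    have hproj : HasFDerivAt (fun y : EuclideanSpace ℝ (Fin d) => y j)
        (EuclideanSpace.proj j : EuclideanSpace ℝ (Fin d) →L[ℝ] ℝ) x :=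
      (EuclideanSpace.proj j : EuclideanSpace ℝ (Fin d) →L[ℝ] ℝ).hasFDerivAt
    have hprod := (hK.comp_hasFDerivAt x (hnorm x hx)).mul hproj
    rw [heq.fderiv_eq]
    refine (congrArg (fun L => L (EuclideanSpace.single j 1)) hprod.fderiv).trans ?_
    simp [EuclideanSpace.inner_single_right]
    field_simp
  have hsum : ∑ j, (x j) ^ 2 = ‖x‖ ^ 2 := by
    simp [EuclideanSpace.norm_sq_eq]
  simp only [lap, hsecond, Finset.sum_add_distrib, ← Finset.mul_sum, hsum]
  simp
  field_simp
  ring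

theorem hasDerivAt_rpow_div_one_add_rpow (ε : ℝ) {r : ℝ} (hr : 0 < r) :
    HasDerivAt (fun s : ℝ => s ^ ε / (1 + s ^ ε))
      (ε * (r ^ ε / (1 + r ^ ε)) * (1 - r ^ ε / (1 + r ^ ε)) / r) r := by
  have hu : 0 < r ^ ε := rpow_pos_of_pos hr ε
  have h := hasDerivAt_rpow_const (p := ε) (Or.inl hr.ne')
  refine (h.div (h.const_add 1) (by positivity)).congr_deriv ?_
  rw [rpow_sub_one hr.ne']
  field_simp

theorem hasDerivAt_integral_rpow_div_one_add_rpow {ε : ℝ} (hε : 0 < ε) {r : ℝ} (hr : 0 < r) :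
    HasDerivAt (fun t : ℝ => ∫ s in (0 : ℝ)..t, s ^ ε / (1 + s ^ ε))
      (r ^ ε / (1 + r ^ ε)) r := by
  have hcont : ContinuousOn (fun s : ℝ => s ^ ε / (1 + s ^ ε)) (Set.Ici 0) := by
    have h := (continuous_id.rpow_const (p := ε) fun _ => Or.inr hε.le).continuousOn
      (s := Set.Ici 0)
    refine h.div (continuousOn_const.add h) fun s hs => ?_
    have := rpow_nonneg (Set.mem_Ici.mp hs) ε
    positivity
  have hmeas : Measurable (fun s : ℝ => s ^ ε / (1 + s ^ ε)) := by fun_prop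
  refine intervalIntegral.integral_hasDerivAt_right ?_
    hmeas.stronglyMeasurable.stronglyMeasurableAtFilter
    (hasDerivAt_rpow_div_one_add_rpow ε hr).continuousAt
  refine (hcont.mono ?_).intervalIntegrable
  rw [Set.uIcc_of_le hr.le]
  exact Set.Icc_subset_Ici_self

/-- The bilaplacian of `ψ_ε` away from the origin, in terms of `p = |x|^ε / (1 + |x|^ε)`. -/
theorem lap_lap_psiEps {d : ℕ} {ε : ℝ} (hε : 0 < ε)
    {x : EuclideanSpace ℝ (Fin d)} (hx : x ≠ 0) {p : ℝ}
    (hp : p = ‖x‖ ^ ε / (1 + ‖x‖ ^ ε)) :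
    lap (lap (psiEps d ε)) x = 1 / ‖x‖ ^ 3 * p *
      (ε ^ 3 * ((1 - p) * (1 - 6 * p + 6 * p ^ 2)) +
        (2 * d - 5) * ε ^ 2 * ((1 - p) * (1 - 2 * p)) +
        ((d : ℝ) ^ 2 - 6 * d + 7) * ε * (1 - p) - (d - 1) * (d - 3)) := by
  set P : ℝ → ℝ := fun s => s ^ ε / (1 + s ^ ε) with hP
  have hPd : ∀ r, 0 < r → HasDerivAt P (ε * P r * (1 - P r) / r) r :=
    fun r hr => hasDerivAt_rpow_div_one_add_rpow ε hr
  have hP' : ∀ r, 0 < r → HasDerivAt (fun s => P s * (1 - P s))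
      (ε * P r * (1 - P r) * (1 - 2 * P r) / r) r := fun r hr =>
    ((hPd r hr).mul ((hPd r hr).const_sub 1)).congr_deriv (by field_simp; ring)
  have hP'' : ∀ r, 0 < r → HasDerivAt (fun s => P s * (1 - P s) * (1 - 2 * P s))
      (ε * P r * (1 - P r) * (1 - 6 * P r + 6 * P r ^ 2) / r) r := fun r hr =>
    ((hP' r hr).mul (((hPd r hr).const_mul 2).const_sub 1)).congr_deriv (by field_simp; ring)
  have hlap : ∀ y, y ≠ 0 → lap (psiEps d ε) y =
      (fun r => (ε * (P r * (1 - P r)) + (d - 1) * P r) / r) ‖y‖ := by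
    intro y hy
    rw [lap_radial (f := psiEps d ε) (F := fun t : ℝ => ∫ s in (0 : ℝ)..t, s ^ ε / (1 + s ^ ε))
      (fun _ _ => rfl) (fun r hr => hasDerivAt_integral_rpow_div_one_add_rpow hε hr) hPd hy]
    have := norm_ne_zero_iff.mpr hy
    simp only [hP]
    field_simp
  rw [lap_radial (F := fun r => (ε * (P r * (1 - P r)) + (d - 1) * P r) / r)
      (F' := fun r => (ε ^ 2 * (P r * (1 - P r) * (1 - 2 * P r)) +
        (d - 2) * ε * (P r * (1 - P r)) - (d - 1) * P r) / r ^ 2)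
      (F'' := fun r => (ε ^ 3 * (P r * (1 - P r) * (1 - 6 * P r + 6 * P r ^ 2)) +
        (d - 4) * ε ^ 2 * (P r * (1 - P r) * (1 - 2 * P r)) -
        (3 * d - 5) * ε * (P r * (1 - P r)) + 2 * (d - 1) * P r) / r ^ 3) hlap ?_ ?_ hx]
  · have := norm_ne_zero_iff.mpr hx
    have hpx : P ‖x‖ = p := hp.symm
    simp only [hpx]
    field_simp
    ring
  · intro r hr
    refine ((((hP' r hr).const_mul ε).add ((hPd r hr).const_mul ((d : ℝ) - 1))).div
      (hasDerivAt_id r) hr.ne').congr_deriv ?_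
    simp
    field_simp
    ring
  · intro r hr
    refine (((((hP'' r hr).const_mul (ε ^ 2)).add ((hP' r hr).const_mul (((d : ℝ) - 2) * ε))).sub
      ((hPd r hr).const_mul ((d : ℝ) - 1))).div
      (hasDerivAt_pow 2 r) (pow_ne_zero 2 hr.ne')).congr_deriv ?_
    simp
    field_simp
    ring

theorem stmt7 (d : ℕ) (hd : 3 ≤ d) (ε : ℝ) (hε0 : 0 < ε) (hε1 : ε < 1)
    (x : EuclideanSpace ℝ (Fin d)) (hx : x ≠ 0) :
    -(1 / 2) * lap (lap (psiEps d ε)) x ≥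
      1 / ‖x‖ ^ 3 * (‖x‖ ^ ε / (1 + ‖x‖ ^ ε)) *
        (((d : ℝ) - 1) * ((d : ℝ) - 3) / 2 - 3 * (d : ℝ) ^ 2 * ε) := by
  have hu : 0 < ‖x‖ ^ ε := rpow_pos_of_pos (norm_pos_iff.mpr hx) ε
  have hd' : (3 : ℝ) ≤ d := by exact_mod_cast hd
  obtain ⟨p, hp⟩ : ∃ p, p = ‖x‖ ^ ε / (1 + ‖x‖ ^ ε) := ⟨_, rfl⟩
  have hp0 : 0 ≤ p := by rw [hp]; positivity
  have hp1 : p ≤ 1 := by rw [hp, div_le_one (by positivity)]; linarith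
  rw [lap_lap_psiEps hε0 hx hp, ← hp]
  have h1 : ε ^ 3 * ((1 - p) * (1 - 6 * p + 6 * p ^ 2)) ≤ ε := by
    have ha : (1 - p) * (1 - 6 * p + 6 * p ^ 2) ≤ 1 := by
      nlinarith [mul_nonneg hp0 (sub_nonneg.mpr hp1),
        mul_nonneg (mul_nonneg hp0 hp0) (sub_nonneg.mpr hp1)]
    have hb : ε ^ 3 ≤ ε := pow_le_of_le_one hε0.le hε1.le (by norm_num)
    nlinarith [pow_pos hε0 3]
  have h2 : ε ^ 2 * ((1 - p) * (1 - 2 * p)) ≤ ε := by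
    have ha : (1 - p) * (1 - 2 * p) ≤ 1 := by nlinarith
    have hb : ε ^ 2 ≤ ε := pow_le_of_le_one hε0.le hε1.le (by norm_num)
    nlinarith [pow_pos hε0 2]
  have h3 : ((d : ℝ) ^ 2 - 6 * d + 7) * ε * (1 - p) ≤ (d : ℝ) ^ 2 * ε := by
    have ha : ((d : ℝ) ^ 2 - 6 * d + 7) * (1 - p) ≤ (d : ℝ) ^ 2 := by
      nlinarith [mul_nonneg (sq_nonneg (d : ℝ)) hp0]
    nlinarith
  have h4 := mul_le_mul_of_nonneg_left h2 (by linarith : (0 : ℝ) ≤ 2 * d - 5)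
  have h5 : (2 * (d : ℝ) - 4) * ε ≤ 5 * (d : ℝ) ^ 2 * ε :=
    mul_le_mul_of_nonneg_right (by nlinarith) hε0.le
  have hc : 0 ≤ 1 / ‖x‖ ^ 3 * p := by positivity
  rw [ge_iff_le, mul_left_comm]
  refine mul_le_mul_of_nonneg_left ?_ hc
  linarith
end

section
/- Let d ≥ 3 be an integer and 0 < ε < 1, and define the bilinear form B(v,w) = ∫_{ℝ^d} conj(v(x)) · (|x|^ε/(1+|x|^ε)) · (x/|x|)·∇w(x) dx for v, w ∈ C_c^∞(ℝ^d; ℂ). Then for all such v, w one has both |B(v,w)| ≤ ‖v‖_{L²} ‖∇w‖_{L²} and |B(v,w)| ≤ (1 + 2d/(d−2)) ‖w‖_{L²} ‖∇v‖_{L²} ≤ 7 ‖w‖_{L²} ‖∇v‖_{L²}. -/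
open MeasureTheory Metric Real

section RadialCalculus

open Set Filter Topology

theorem integral_eq_integral_sphere_integral_Ioi {E F : Type*} [NormedAddCommGroup E]
    [NormedSpace ℝ E] [FiniteDimensional ℝ E] [Nontrivial E] [MeasurableSpace E] [BorelSpace E]
    (μ : Measure E) [μ.IsAddHaarMeasure] [NormedAddCommGroup F] [NormedSpace ℝ F]
    {f : E → F} (hf : Integrable f μ) :
    ∫ x, f x ∂μ = ∫ θ : sphere (0 : E) 1, (∫ r in Ioi (0 : ℝ),
      r ^ (Module.finrank ℝ E - 1) • f (r • (θ : E))) ∂μ.toSphere := by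
  have hmp := μ.measurePreserving_homeomorphUnitSphereProd
  have hemb := (homeomorphUnitSphereProd E).measurableEmbedding
  set G : sphere (0 : E) 1 × Ioi (0 : ℝ) → F := fun p ↦ f (p.2.1 • (p.1 : E))
  have hG : G ∘ homeomorphUnitSphereProd E = f ∘ ((↑) : ({0}ᶜ : Set E) → E) := by
    ext x
    have hx : ‖(x : E)‖ ≠ 0 := norm_ne_zero_iff.2 x.2
    simp [G, smul_smul, hx]
  have hint : Integrable G (μ.toSphere.prod (.volumeIoiPow (Module.finrank ℝ E - 1))) := by
    rw [← hmp.integrable_comp_emb hemb, hG,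
      ← integrableOn_iff_comap_subtypeVal (measurableSet_singleton _).compl]
    exact hf.integrableOn
  calc
    ∫ x, f x ∂μ = ∫ x : ({(0)}ᶜ : Set E), f x ∂(μ.comap (↑)) := by
      rw [integral_subtype_comap (measurableSet_singleton _).compl f, restrict_compl_singleton]
    _ = ∫ p, G p ∂μ.toSphere.prod (.volumeIoiPow (Module.finrank ℝ E - 1)) := by
      rw [← hmp.integral_comp hemb]
      exact congrArg (fun k ↦ ∫ x, k x ∂(μ.comap (↑))) hG.symm
    _ = _ := by
      rw [integral_prod _ hint]
      refine integral_congr_ae (.of_forall fun θ ↦ ?_)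
      simp only [Measure.volumeIoiPow, ENNReal.ofReal, G]
      rw [integral_withDensity_eq_integral_smul
          (measurable_subtype_coe.pow_const _).real_toNNReal,
        integral_subtype_comap measurableSet_Ioi
          fun a ↦ Real.toNNReal (a ^ (Module.finrank ℝ E - 1)) • f (a • (θ : E))]
      refine setIntegral_congr_fun measurableSet_Ioi fun x hx ↦ ?_
      simp only [NNReal.smul_def, Real.coe_toNNReal _ (pow_nonneg (mem_Ioi.1 hx).le _)]

/-- The divergence theorem for the vector field `x ↦ h x • x`, where `g` is the derivative of `h`
in the direction `x`. -/
theorem integral_radial_divergence_eq_zero {E F : Type*} [NormedAddCommGroup E]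
    [NormedSpace ℝ E] [FiniteDimensional ℝ E] [Nontrivial E] [MeasurableSpace E] [BorelSpace E]
    (μ : Measure E) [μ.IsAddHaarMeasure] [NormedAddCommGroup F] [NormedSpace ℝ F] [CompleteSpace F]
    {h g : E → F} (hder : ∀ x ≠ 0, HasDerivAt (fun t : ℝ ↦ h (t • x)) (g x) 1)
    (hsupp : HasCompactSupport h)
    (hzero : Tendsto (fun x ↦ ‖x‖ ^ Module.finrank ℝ E • h x) (𝓝 0) (𝓝 0))
    (hint : Integrable (fun x ↦ (Module.finrank ℝ E : ℝ) • h x + g x) μ) :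
    ∫ x, ((Module.finrank ℝ E : ℝ) • h x + g x) ∂μ = 0 := by
  have hn : Module.finrank ℝ E ≠ 0 := Module.finrank_pos.ne'
  rw [integral_eq_integral_sphere_integral_Ioi μ hint]
  refine integral_eq_zero_of_ae (.of_forall fun θ ↦ ?_)
  generalize Module.finrank ℝ E = n at *
  by_cases hI : IntegrableOn (fun r : ℝ ↦ r ^ (n - 1) • ((n : ℝ) • h (r • (θ : E)) +
      g (r • (θ : E)))) (Ioi 0)
  swap
  · exact integral_undef hI
  have hθ : ‖(θ : E)‖ = 1 := by simp
  have hθ0 : (θ : E) ≠ 0 := by rw [← norm_ne_zero_iff, hθ]; simp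
  have hray : ∀ r ∈ Ioi (0 : ℝ), HasDerivAt (fun s : ℝ ↦ h (s • (θ : E)))
      (r⁻¹ • g (r • (θ : E))) r := by
    intro r hr
    have hr0 : r ≠ 0 := (mem_Ioi.1 hr).ne'
    have h1 := hder (r • (θ : E)) (smul_ne_zero hr0 hθ0)
    have h2 : HasDerivAt (fun s : ℝ ↦ s * r⁻¹) r⁻¹ r := by
      simpa using (hasDerivAt_id r).mul_const r⁻¹
    refine (h1.scomp_of_eq r h2 (mul_inv_cancel₀ hr0).symm).congr_of_eventuallyEq (.of_forall fun s ↦ ?_)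
    simp [smul_smul, hr0]
  have hderiv : ∀ r ∈ Ioi (0 : ℝ), HasDerivAt (fun s : ℝ ↦ s ^ n • h (s • (θ : E)))
      (r ^ (n - 1) • ((n : ℝ) • h (r • (θ : E)) + g (r • (θ : E)))) r := by
    intro r hr
    have hr0 : r ≠ 0 := (mem_Ioi.1 hr).ne'
    convert! (hasDerivAt_pow n r).smul (hray r hr) using 1
    have : r ^ n * r⁻¹ = r ^ (n - 1) := by
      rw [← Nat.sub_add_cancel (Nat.one_le_iff_ne_zero.2 hn), pow_succ]; simp [hr0]
    rw [smul_smul, this, smul_add, smul_smul, mul_comm (n : ℝ), add_comm]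
  have hlim : Tendsto (fun s : ℝ ↦ s ^ n • h (s • (θ : E))) atTop (𝓝 0) := by
    refine tendsto_const_nhds.congr' ?_
    obtain ⟨R, hR⟩ := hsupp.isCompact.isBounded.subset_closedBall (0 : E)
    filter_upwards [eventually_gt_atTop (max R 0)] with s hs
    rw [image_eq_zero_of_notMem_tsupport (f := h), smul_zero]
    intro hmem
    have := hR hmem
    have hs0 : 0 < s := (le_max_right _ _).trans_lt hs
    rw [mem_closedBall, dist_zero_right, norm_smul, hθ, mul_one, Real.norm_of_nonneg hs0.le] at this
    exact absurd ((le_max_left R 0).trans_lt hs) (not_lt.2 this)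
  have hcont : ContinuousWithinAt (fun s : ℝ ↦ s ^ n • h (s • (θ : E))) (Ici 0) 0 := by
    have hcomp : Tendsto (fun s : ℝ ↦ s • (θ : E)) (𝓝[≥] 0) (𝓝 0) := by
      have : Continuous fun s : ℝ ↦ s • (θ : E) := by fun_prop
      simpa using (this.tendsto 0).mono_left nhdsWithin_le_nhds
    have := hzero.comp hcomp
    simp only [ContinuousWithinAt, zero_pow hn, zero_smul]
    refine this.congr' ?_
    filter_upwards [self_mem_nhdsWithin] with s hs
    simp [norm_smul, abs_of_nonneg (mem_Ici.1 hs)]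
  exact (integral_Ioi_of_hasDerivAt_of_tendsto hcont hderiv hI hlim).trans (by simp [hn])

theorem nontrivial_of_three_le_finrank {E : Type*} [NormedAddCommGroup E] [NormedSpace ℝ E]
    (hE : 3 ≤ Module.finrank ℝ E) : Nontrivial E :=
  Module.nontrivial_of_finrank_pos (R := ℝ) (by omega)

variable {E : Type*} [NormedAddCommGroup E] [NormedSpace ℝ E] [FiniteDimensional ℝ E]
  [MeasurableSpace E] [BorelSpace E] (μ : Measure E) [μ.IsAddHaarMeasure]

theorem integrable_one_add_inv_norm_sq_mul (hE : 3 ≤ Module.finrank ℝ E) {f : E → ℂ}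
    (hf : Continuous f) (hfs : HasCompactSupport f) :
    Integrable (fun x ↦ (1 + (‖x‖ ^ 2)⁻¹) * ‖f x‖) μ := by
  have := nontrivial_of_three_le_finrank hE
  obtain ⟨R, hR⟩ := hfs.isCompact.isBounded.subset_ball (0 : E)
  obtain ⟨C, hC⟩ := hf.bounded_above_of_compact_support hfs
  have hrad : IntegrableOn (fun x : E ↦ 1 + (‖x‖ ^ 2)⁻¹) (ball 0 R) μ := by
    rw [integrableOn_fun_norm_addHaar μ (f := fun r ↦ 1 + (r ^ 2)⁻¹)]
    generalize Module.finrank ℝ E = n at hE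
    have hc : Continuous fun y : ℝ ↦ y ^ (n - 1) + y ^ (n - 3) := by fun_prop
    refine ((hc.integrableOn_Icc (a := 0) (b := R)).mono_set Ioo_subset_Icc_self).congr_fun
      (fun y hy ↦ ?_) measurableSet_Ioo
    have hy0 : y ≠ 0 := hy.1.ne'
    obtain ⟨m, rfl⟩ := Nat.exists_eq_add_of_le hE
    have h1 : 3 + m - 1 = m + 2 := by omega
    have h2 : 3 + m - 3 = m := by omega
    simp only [h1, h2, smul_eq_mul]
    field_simp
    ring
  have hmul : IntegrableOn (fun x ↦ (1 + (‖x‖ ^ 2)⁻¹) * ‖f x‖) (ball 0 R) μ :=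
    Integrable.mul_bdd (c := C) hrad hf.norm.aestronglyMeasurable
      (.of_forall fun x ↦ by simpa using hC x)
  refine (integrableOn_iff_integrable_of_support_subset fun x hx ↦ ?_).1 hmul
  refine hR (subset_tsupport _ fun h0 ↦ hx ?_)
  simp [h0]

theorem integrable_radial_mul (hE : 3 ≤ Module.finrank ℝ E) {ρ : ℝ → ℝ} (hρ : Measurable ρ)
    {C : ℝ} (hC : ∀ r > 0, |ρ r| ≤ C * (1 + (r ^ 2)⁻¹)) {f : E → ℂ}
    (hf : Continuous f) (hfs : HasCompactSupport f) :
    Integrable (fun x ↦ (ρ ‖x‖ : ℂ) * f x) μ := by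
  have := nontrivial_of_three_le_finrank hE
  refine ((integrable_one_add_inv_norm_sq_mul μ hE hf hfs).const_mul C).mono' ?_ ?_
  · exact ((Complex.measurable_ofReal.comp (hρ.comp measurable_norm)).mul
      hf.measurable).aestronglyMeasurable
  · filter_upwards [Measure.ae_ne μ (0 : E)] with x hx
    rw [norm_mul, Complex.norm_real, Real.norm_eq_abs, ← mul_assoc]
    exact mul_le_mul_of_nonneg_right (hC _ (norm_pos_iff.2 hx)) (norm_nonneg _)

/-- Integration by parts in the radial direction, against a radial weight which may have a
quadratic singularity at the origin. -/
theorem integral_radial_mul_conj_mul_fderiv (hE : 3 ≤ Module.finrank ℝ E) {ρ ρ' : ℝ → ℝ}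
    (hρ : Measurable ρ) (hρ' : Measurable ρ') (hder : ∀ r > 0, HasDerivAt ρ (ρ' r) r)
    {C : ℝ} (hC : ∀ r > 0, |ρ r| ≤ C * (1 + (r ^ 2)⁻¹))
    (hC' : ∀ r > 0, |r * ρ' r| ≤ C * (1 + (r ^ 2)⁻¹)) {v w : E → ℂ}
    (hv : ContDiff ℝ 1 v) (hvs : HasCompactSupport v)
    (hw : ContDiff ℝ 1 w) (hws : HasCompactSupport w) :
    ∫ x, (ρ ‖x‖ : ℂ) * (starRingEnd ℂ (v x) * fderiv ℝ w x x) ∂μ =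
      - ∫ x, (ρ ‖x‖ : ℂ) * (starRingEnd ℂ (fderiv ℝ v x x) * w x) ∂μ -
      ∫ x, ((Module.finrank ℝ E * ρ ‖x‖ + ‖x‖ * ρ' ‖x‖ : ℝ) : ℂ) *
        (starRingEnd ℂ (v x) * w x) ∂μ := by
  have := nontrivial_of_three_le_finrank hE
  have hvc : Continuous fun x ↦ starRingEnd ℂ (v x) := Complex.continuous_conj.comp hv.continuous
  have hdv : Continuous fun x ↦ fderiv ℝ v x x :=
    (hv.continuous_fderiv one_ne_zero).clm_apply continuous_id
  have hdw : Continuous fun x ↦ fderiv ℝ w x x :=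
    (hw.continuous_fderiv one_ne_zero).clm_apply continuous_id
  have hvcs : HasCompactSupport fun x ↦ starRingEnd ℂ (v x) := hvs.comp_left (map_zero _)
  have hprod : Continuous fun x ↦ starRingEnd ℂ (v x) * w x := hvc.mul hw.continuous
  have hprods : HasCompactSupport fun x ↦ starRingEnd ℂ (v x) * w x := hvcs.mul_right
  have i1 : Integrable (fun x ↦ (ρ ‖x‖ : ℂ) * (starRingEnd ℂ (v x) * fderiv ℝ w x x)) μ :=
    integrable_radial_mul μ hE hρ hC (hvc.mul hdw) hvcs.mul_right
  have i2 : Integrable (fun x ↦ (ρ ‖x‖ : ℂ) * (starRingEnd ℂ (fderiv ℝ v x x) * w x)) μ :=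
    integrable_radial_mul μ hE hρ hC
      ((Complex.continuous_conj.comp hdv).mul hw.continuous) hws.mul_left
  have i3 : Integrable (fun x ↦ ((Module.finrank ℝ E * ρ ‖x‖ + ‖x‖ * ρ' ‖x‖ : ℝ) : ℂ) *
      (starRingEnd ℂ (v x) * w x)) μ := by
    refine (((integrable_radial_mul μ hE hρ hC hprod hprods).const_mul
      (Module.finrank ℝ E : ℂ)).add (integrable_radial_mul μ hE (measurable_id.mul hρ') hC'
        hprod hprods)).congr (.of_forall fun x ↦ ?_)
    simp only [Pi.add_apply, Pi.mul_apply, id]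
    push_cast
    ring
  have i23 := i2.add i3
  have i123 := i1.add i23
  simp only [Pi.add_def] at i23 i123
  have key := integral_radial_divergence_eq_zero μ
    (h := fun x ↦ (ρ ‖x‖ : ℂ) * (starRingEnd ℂ (v x) * w x))
    (g := fun x ↦ ((‖x‖ * ρ' ‖x‖ : ℝ) : ℂ) * (starRingEnd ℂ (v x) * w x) +
      ((ρ ‖x‖ : ℂ) * (starRingEnd ℂ (fderiv ℝ v x x) * w x) +
      (ρ ‖x‖ : ℂ) * (starRingEnd ℂ (v x) * fderiv ℝ w x x))) ?_ ?_ ?_ ?_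
  · rw [sub_eq_add_neg, ← neg_add, eq_neg_iff_add_eq_zero, ← key]
    rw [← integral_add i2 i3, ← integral_add i1 i23]
    refine integral_congr_ae (.of_forall fun x ↦ ?_)
    simp only [Complex.real_smul]
    push_cast
    ring
  · intro x hx
    have hline (u : E → ℂ) (hu : ContDiff ℝ 1 u) :
        HasDerivAt (fun t : ℝ ↦ u (t • x)) (fderiv ℝ u x x) 1 := by
      have h1 : HasDerivAt (fun t : ℝ ↦ t • x) x 1 := by
        simpa using (hasDerivAt_id (1 : ℝ)).smul_const x
      exact (hu.differentiable one_ne_zero x).hasFDerivAt.comp_hasDerivAt_of_eq 1 h1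
        (one_smul ℝ x).symm
    have hr : HasDerivAt (fun t : ℝ ↦ ρ ‖t • x‖) (‖x‖ * ρ' ‖x‖) 1 := by
      have h1 : HasDerivAt (fun t : ℝ ↦ t * ‖x‖) ‖x‖ 1 := by
        simpa using (hasDerivAt_id (1 : ℝ)).mul_const ‖x‖
      refine (((hder ‖x‖ (norm_pos_iff.2 hx)).scomp_of_eq 1 h1
        (one_mul _).symm)).congr_of_eventuallyEq ?_
      filter_upwards [eventually_gt_nhds (zero_lt_one (α := ℝ))] with t ht
      simp [norm_smul, abs_of_pos ht]
    have := hr.ofReal_comp.mul ((hline v hv).star.mul (hline w hw))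
    convert! this using 1
    simp [Pi.mul_apply]
    ring
  · exact hprods.mul_left
  · have hbd : Tendsto (fun x ↦ (‖x‖ ^ Module.finrank ℝ E + ‖x‖ ^ (Module.finrank ℝ E - 2)) *
        (C * ‖starRingEnd ℂ (v x) * w x‖)) (𝓝 0) (𝓝 0) := by
      have hc : Continuous fun x ↦ (‖x‖ ^ Module.finrank ℝ E + ‖x‖ ^ (Module.finrank ℝ E - 2)) *
        (C * ‖starRingEnd ℂ (v x) * w x‖) := by fun_prop
      have h0 : Module.finrank ℝ E ≠ 0 := by omega
      have h2 : Module.finrank ℝ E - 2 ≠ 0 := by omega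
      simpa [h0, h2] using hc.tendsto 0
    refine squeeze_zero_norm (fun x ↦ ?_) hbd
    generalize Module.finrank ℝ E = n at hE
    obtain ⟨m, rfl⟩ := Nat.exists_eq_add_of_le hE
    have hm : 3 + m - 2 = m + 1 := by omega
    rcases eq_or_ne x 0 with rfl | hx
    · simp [hm]
    · have hx0 := norm_pos_iff.2 hx
      rw [norm_smul, norm_mul, norm_pow, norm_norm, Complex.norm_real, Real.norm_eq_abs, ← mul_assoc,
        ← mul_assoc]
      refine mul_le_mul_of_nonneg_right ?_ (norm_nonneg _)
      calc ‖x‖ ^ (3 + m) * |ρ ‖x‖| ≤ ‖x‖ ^ (3 + m) * (C * (1 + (‖x‖ ^ 2)⁻¹)) := by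
            gcongr; exact hC _ hx0
        _ = _ := by rw [hm]; field_simp; ring
  · refine i123.congr (.of_forall fun x ↦ ?_)
    simp only [Complex.real_smul]
    push_cast
    ring

theorem norm_integral_le_of_norm_le_mul {α : Type*} [MeasurableSpace α] {ν : Measure α}
    {F : α → ℂ} {f g : α → ℝ} (hf0 : ∀ x, 0 ≤ f x) (hg0 : ∀ x, 0 ≤ g x)
    (hf : MemLp f 2 ν) (hg : MemLp g 2 ν) (h : ∀ᵐ x ∂ν, ‖F x‖ ≤ f x * g x) :
    ‖∫ x, F x ∂ν‖ ≤ (∫ x, f x ^ 2 ∂ν) ^ (1 / 2 : ℝ) * (∫ x, g x ^ 2 ∂ν) ^ (1 / 2 : ℝ) := by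
  refine (norm_integral_le_of_norm_le (hf.integrable_mul hg) h).trans ?_
  have := integral_mul_le_Lp_mul_Lq_of_nonneg Real.HolderConjugate.two_two
    (.of_forall hf0) (.of_forall hg0) (by simpa using hf) (by simpa using hg)
  simpa using this

theorem memLp_two_norm_div_norm (hE : 3 ≤ Module.finrank ℝ E) {v : E → ℂ} (hv : Continuous v)
    (hvs : HasCompactSupport v) : MemLp (fun x ↦ ‖v x‖ / ‖x‖) 2 μ := by
  have hm : AEStronglyMeasurable (fun x ↦ ‖v x‖ / ‖x‖) μ :=
    (hv.norm.measurable.div measurable_norm).aestronglyMeasurable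
  rw [memLp_two_iff_integrable_sq hm]
  have hc : HasCompactSupport fun x ↦ v x * v x := hvs.mul_right
  refine (integrable_one_add_inv_norm_sq_mul μ hE (hv.mul hv) hc).mono' (hm.pow 2)
    (.of_forall fun x ↦ ?_)
  rw [Pi.mul_apply, norm_mul, Real.norm_of_nonneg (by positivity), div_pow, div_eq_mul_inv, mul_comm, ← sq]
  gcongr
  simp

/-- Hardy's inequality, with the operator norm of the derivative. -/
theorem hardy_inequality (hE : 3 ≤ Module.finrank ℝ E) {v : E → ℂ}
    (hv : ContDiff ℝ 1 v) (hvs : HasCompactSupport v) :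
    (∫ x, (‖v x‖ / ‖x‖) ^ 2 ∂μ) ^ (1 / 2 : ℝ) ≤
      2 / ((Module.finrank ℝ E : ℝ) - 2) * (∫ x, ‖fderiv ℝ v x‖ ^ 2 ∂μ) ^ (1 / 2 : ℝ) := by
  have hn : (0 : ℝ) < (Module.finrank ℝ E : ℝ) - 2 := by
    have : (3 : ℝ) ≤ Module.finrank ℝ E := by exact_mod_cast hE
    linarith
  have := nontrivial_of_three_le_finrank hE
  have hH := memLp_two_norm_div_norm μ hE hv.continuous hvs
  have hD : MemLp (fun x ↦ ‖fderiv ℝ v x‖) 2 μ :=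
    (hv.continuous_fderiv one_ne_zero).norm.memLp_of_hasCompactSupport (hvs.fderiv ℝ).norm
  have key := integral_radial_mul_conj_mul_fderiv μ hE (ρ := fun r ↦ (r ^ 2)⁻¹)
    (ρ' := fun r ↦ -(2 * r) / (r ^ 2) ^ 2) (by fun_prop) (by fun_prop)
    (fun r hr ↦ by simpa using (hasDerivAt_pow 2 r).fun_inv (by positivity)) (C := 2)
    (fun r hr ↦ by rw [abs_of_nonneg (by positivity)]; nlinarith [inv_pos.2 (pow_pos hr 2)])
    (fun r hr ↦ by
      have : r * (-(2 * r) / (r ^ 2) ^ 2) = -(2 * (r ^ 2)⁻¹) := by field_simp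
      rw [this, abs_neg, abs_of_nonneg (by positivity)]; linarith)
    hv hvs hv hvs
  have hlast : ∫ x, ((Module.finrank ℝ E * (‖x‖ ^ 2)⁻¹ +
      ‖x‖ * (-(2 * ‖x‖) / (‖x‖ ^ 2) ^ 2) : ℝ) : ℂ) * (starRingEnd ℂ (v x) * v x) ∂μ =
      (((Module.finrank ℝ E - 2) * ∫ x, (‖v x‖ / ‖x‖) ^ 2 ∂μ : ℝ) : ℂ) := by
    rw [← integral_const_mul, ← integral_complex_ofReal]
    refine integral_congr_ae ?_
    filter_upwards [Measure.ae_ne μ (0 : E)] with x hx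
    have hx0 : ‖x‖ ≠ 0 := norm_ne_zero_iff.2 hx
    rw [Complex.conj_mul']
    rw [← Complex.ofReal_pow, ← Complex.ofReal_mul]
    congr 1
    field_simp
    ring
  rw [hlast] at key
  set A := ∫ x, (((‖x‖ ^ 2)⁻¹ : ℝ) : ℂ) * (starRingEnd ℂ (v x) * fderiv ℝ v x x) ∂μ
  set B := ∫ x, (((‖x‖ ^ 2)⁻¹ : ℝ) : ℂ) * (starRingEnd ℂ (fderiv ℝ v x x) * v x) ∂μ
  have hA : ‖A‖ ≤ _ := norm_integral_le_of_norm_le_mul (fun x ↦ by positivity)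
    (fun x ↦ norm_nonneg _) hH hD <| by
      filter_upwards [Measure.ae_ne μ (0 : E)] with x hx
      have hx0 : 0 < ‖x‖ := norm_pos_iff.2 hx
      have := (fderiv ℝ v x).le_opNorm x
      rw [norm_mul, norm_mul, Complex.norm_real, RCLike.norm_conj, norm_inv, norm_pow, norm_norm]
      calc _ ≤ (‖x‖ ^ 2)⁻¹ * (‖v x‖ * (‖fderiv ℝ v x‖ * ‖x‖)) := by gcongr
        _ = _ := by field_simp
  have hB : ‖B‖ ≤ _ := norm_integral_le_of_norm_le_mul (fun x ↦ by positivity)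
    (fun x ↦ norm_nonneg _) hH hD <| by
      filter_upwards [Measure.ae_ne μ (0 : E)] with x hx
      have hx0 : 0 < ‖x‖ := norm_pos_iff.2 hx
      have := (fderiv ℝ v x).le_opNorm x
      rw [norm_mul, norm_mul, Complex.norm_real, RCLike.norm_conj, norm_inv, norm_pow, norm_norm]
      calc _ ≤ (‖x‖ ^ 2)⁻¹ * ((‖fderiv ℝ v x‖ * ‖x‖) * ‖v x‖) := by gcongr
        _ = _ := by field_simp
  set D := (∫ x, ‖fderiv ℝ v x‖ ^ 2 ∂μ) ^ (1 / 2 : ℝ)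
  have hI : 0 ≤ ∫ x, (‖v x‖ / ‖x‖) ^ 2 ∂μ := integral_nonneg fun x ↦ by positivity
  set I := ∫ x, (‖v x‖ / ‖x‖) ^ 2 ∂μ
  have hsq : I = I ^ (1 / 2 : ℝ) * I ^ (1 / 2 : ℝ) := by
    rw [← Real.sqrt_eq_rpow, Real.mul_self_sqrt hI]
  have hS : 0 ≤ I ^ (1 / 2 : ℝ) := by positivity
  have hDnn : 0 ≤ D := by positivity
  have hmain : (Module.finrank ℝ E - 2) * I ≤ 2 * (I ^ (1 / 2 : ℝ) * D) := by
    calc (Module.finrank ℝ E - 2) * I = ‖(((Module.finrank ℝ E - 2) * I : ℝ) : ℂ)‖ := by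
          rw [Complex.norm_real, Real.norm_of_nonneg (by positivity)]
      _ = ‖-A - B‖ := by rw [key]; congr 1; ring
      _ ≤ ‖A‖ + ‖B‖ := by simpa using norm_sub_le (-A) B
      _ ≤ _ := by linarith
  generalize I ^ (1 / 2 : ℝ) = S at *
  rw [div_mul_eq_mul_div, le_div_iff₀ hn]
  rcases hS.eq_or_lt with h0 | hpos
  · rw [← h0]; simpa using hDnn
  · refine le_of_mul_le_mul_left ?_ hpos
    rw [hsq] at hmain
    linarith

end RadialCalculus

theorem stmt9 (d : ℕ) (hd : 3 ≤ d) (ε : ℝ) (hε0 : 0 < ε) (hε1 : ε < 1)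
    (v w : EuclideanSpace ℝ (Fin d) → ℂ)
    (hv : ContDiff ℝ (⊤ : ℕ∞) v) (hvs : HasCompactSupport v)
    (hw : ContDiff ℝ (⊤ : ℕ∞) w) (hws : HasCompactSupport w) :
    ‖∫ x, starRingEnd ℂ (v x) *
        (((‖x‖ ^ ε / (1 + ‖x‖ ^ ε) : ℝ) : ℂ) * fderiv ℝ w x (‖x‖⁻¹ • x))‖ ≤
        (∫ x, ‖v x‖ ^ 2) ^ (1 / 2 : ℝ) *
          (∫ x, ‖fderiv ℝ w x‖ ^ 2) ^ (1 / 2 : ℝ) ∧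
      ‖∫ x, starRingEnd ℂ (v x) *
          (((‖x‖ ^ ε / (1 + ‖x‖ ^ ε) : ℝ) : ℂ) * fderiv ℝ w x (‖x‖⁻¹ • x))‖ ≤
        (1 + 2 * (d : ℝ) / ((d : ℝ) - 2)) * (∫ x, ‖w x‖ ^ 2) ^ (1 / 2 : ℝ) *
          (∫ x, ‖fderiv ℝ v x‖ ^ 2) ^ (1 / 2 : ℝ) ∧
      (1 + 2 * (d : ℝ) / ((d : ℝ) - 2)) * (∫ x, ‖w x‖ ^ 2) ^ (1 / 2 : ℝ) *
          (∫ x, ‖fderiv ℝ v x‖ ^ 2) ^ (1 / 2 : ℝ) ≤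
        7 * (∫ x, ‖w x‖ ^ 2) ^ (1 / 2 : ℝ) *
          (∫ x, ‖fderiv ℝ v x‖ ^ 2) ^ (1 / 2 : ℝ) := by
  have hE : 3 ≤ Module.finrank ℝ (EuclideanSpace ℝ (Fin d)) := by simpa using hd
  have := nontrivial_of_three_le_finrank hE
  have hd3 : (3 : ℝ) ≤ d := by exact_mod_cast hd
  have hd2 : (0 : ℝ) < d - 2 := by linarith
  replace hv : ContDiff ℝ 1 v := hv.of_le (by exact_mod_cast le_top)
  replace hw : ContDiff ℝ 1 w := hw.of_le (by exact_mod_cast le_top)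
  have hvL : MemLp (fun x ↦ ‖v x‖) 2 volume :=
    hv.continuous.norm.memLp_of_hasCompactSupport hvs.norm
  have hwL : MemLp (fun x ↦ ‖w x‖) 2 volume :=
    hw.continuous.norm.memLp_of_hasCompactSupport hws.norm
  have hdvL : MemLp (fun x ↦ ‖fderiv ℝ v x‖) 2 volume :=
    (hv.continuous_fderiv one_ne_zero).norm.memLp_of_hasCompactSupport (hvs.fderiv ℝ).norm
  have hdwL : MemLp (fun x ↦ ‖fderiv ℝ w x‖) 2 volume :=
    (hw.continuous_fderiv one_ne_zero).norm.memLp_of_hasCompactSupport (hws.fderiv ℝ).norm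
  have hφ0 (r : ℝ) (hr : 0 ≤ r) : 0 ≤ r ^ ε / (1 + r ^ ε) := by positivity
  have hφ1 (r : ℝ) (hr : 0 ≤ r) : r ^ ε / (1 + r ^ ε) ≤ 1 := by
    have := rpow_nonneg hr ε
    rw [div_le_one (by positivity)]; linarith
  refine ⟨?_, ?_, ?_⟩
  · refine norm_integral_le_of_norm_le_mul (fun x ↦ norm_nonneg _) (fun x ↦ norm_nonneg _)
      hvL hdwL (.of_forall fun x ↦ ?_)
    have h1 : ‖fderiv ℝ w x (‖x‖⁻¹ • x)‖ ≤ ‖fderiv ℝ w x‖ := by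
      refine (fderiv ℝ w x).unit_le_opNorm _ ?_
      rw [norm_smul, norm_inv, norm_norm]
      exact inv_mul_le_one
    rw [norm_mul, norm_mul, RCLike.norm_conj, Complex.norm_real,
      Real.norm_of_nonneg (hφ0 _ (norm_nonneg x))]
    gcongr
    exact (mul_le_mul (hφ1 _ (norm_nonneg x)) h1 (norm_nonneg _) zero_le_one).trans_eq (one_mul _)
  · set ρ : ℝ → ℝ := fun r ↦ r ^ ε / (1 + r ^ ε) * r⁻¹ with hρ
    set ρ' : ℝ → ℝ := fun r ↦ ε * r ^ (ε - 1) / (1 + r ^ ε) ^ 2 * r⁻¹ -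
      r ^ ε / (1 + r ^ ε) * (r ^ 2)⁻¹ with hρ'
    have hinv (r : ℝ) : r⁻¹ ≤ 1 * (1 + (r ^ 2)⁻¹) := by
      rw [← inv_pow]; nlinarith [sq_nonneg (1 - r⁻¹), sq_nonneg (1 + r⁻¹)]
    have hρ0 (r : ℝ) (hr : 0 < r) : 0 ≤ ρ r := mul_nonneg (hφ0 r hr.le) (inv_nonneg.2 hr.le)
    have hρ1 (r : ℝ) (hr : 0 < r) : ρ r ≤ r⁻¹ :=
      mul_le_of_le_one_left (inv_nonneg.2 hr.le) (hφ1 r hr.le)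
    have hsum (r : ℝ) (hr : 0 < r) : 0 ≤ ρ r + r * ρ' r ∧ ρ r + r * ρ' r ≤ r⁻¹ := by
      have hpos := rpow_pos_of_pos hr ε
      have heq : ρ r + r * ρ' r = ε * r ^ ε / (1 + r ^ ε) ^ 2 * r⁻¹ := by
        simp only [hρ, hρ', rpow_sub_one hr.ne']
        field_simp
        ring
      rw [heq]
      refine ⟨by positivity, mul_le_of_le_one_left (inv_nonneg.2 hr.le) ?_⟩
      rw [div_le_one (by positivity)]
      nlinarith
    have hder (r : ℝ) (hr : 0 < r) : HasDerivAt ρ (ρ' r) r := by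
      have hpos := rpow_pos_of_pos hr ε
      have h1 := Real.hasDerivAt_rpow_const (p := ε) (.inl hr.ne')
      have h2 := (h1.fun_div (h1.const_add 1) (by positivity)).fun_mul (hasDerivAt_inv hr.ne')
      convert! h2 using 1
      simp only [hρ']
      field_simp
      ring
    have key := integral_radial_mul_conj_mul_fderiv volume hE (ρ := ρ) (ρ' := ρ')
      (by fun_prop) (by fun_prop) hder (C := 1)
      (fun r hr ↦ by rw [abs_of_nonneg (hρ0 r hr)]; exact (hρ1 r hr).trans (hinv r))
      (fun r hr ↦ (abs_le.2 ⟨by linarith [hρ1 r hr, (hsum r hr).1],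
        by linarith [hρ0 r hr, (hsum r hr).2]⟩ : _ ≤ r⁻¹).trans (hinv r)) hv hvs hw hws
    have hB : ∫ x, starRingEnd ℂ (v x) *
        (((‖x‖ ^ ε / (1 + ‖x‖ ^ ε) : ℝ) : ℂ) * fderiv ℝ w x (‖x‖⁻¹ • x)) =
        ∫ x, (ρ ‖x‖ : ℂ) * (starRingEnd ℂ (v x) * fderiv ℝ w x x) := by
      refine integral_congr_ae (.of_forall fun x ↦ ?_)
      simp only [hρ, map_smul, Complex.real_smul]
      push_cast
      ring
    rw [hB, key, finrank_euclideanSpace_fin]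
    have hI := norm_integral_le_of_norm_le_mul
      (F := fun x ↦ (ρ ‖x‖ : ℂ) * (starRingEnd ℂ (fderiv ℝ v x x) * w x))
      (fun x ↦ norm_nonneg _) (fun x ↦ norm_nonneg _) hwL hdvL <| by
        filter_upwards [Measure.ae_ne volume (0 : EuclideanSpace ℝ (Fin d))] with x hx
        have hx0 : 0 < ‖x‖ := norm_pos_iff.2 hx
        have := (fderiv ℝ v x).le_opNorm x
        rw [norm_mul, norm_mul, RCLike.norm_conj, Complex.norm_real,
          Real.norm_of_nonneg (hρ0 _ hx0)]
        calc _ ≤ ‖x‖⁻¹ * ((‖fderiv ℝ v x‖ * ‖x‖) * ‖w x‖) := by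
              gcongr; exact hρ1 _ hx0
          _ = _ := by field_simp
    have hJ := norm_integral_le_of_norm_le_mul
      (F := fun x ↦ ((d * ρ ‖x‖ + ‖x‖ * ρ' ‖x‖ : ℝ) : ℂ) * (starRingEnd ℂ (v x) * w x))
      (fun x ↦ by positivity) (fun x ↦ by positivity) (hwL.const_mul (d : ℝ))
      (memLp_two_norm_div_norm volume hE hv.continuous hvs) <| by
        filter_upwards [Measure.ae_ne volume (0 : EuclideanSpace ℝ (Fin d))] with x hx
        have hx0 : 0 < ‖x‖ := norm_pos_iff.2 hx
        have hle : |d * ρ ‖x‖ + ‖x‖ * ρ' ‖x‖| ≤ d * ‖x‖⁻¹ := by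
          obtain ⟨h1, h2⟩ := hsum _ hx0
          have h3 : 0 ≤ (d - 1) * ρ ‖x‖ := mul_nonneg (by linarith) (hρ0 _ hx0)
          have h4 : (d - 1) * ρ ‖x‖ ≤ (d - 1) * ‖x‖⁻¹ :=
            mul_le_mul_of_nonneg_left (hρ1 _ hx0) (by linarith)
          rw [abs_of_nonneg (by linarith)]
          linarith
        rw [norm_mul, norm_mul, RCLike.norm_conj, Complex.norm_real, Real.norm_eq_abs]
        calc _ ≤ d * ‖x‖⁻¹ * (‖v x‖ * ‖w x‖) := by gcongr
          _ = _ := by ring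
    have hscale : (∫ x, ((d : ℝ) * ‖w x‖) ^ 2) ^ (1 / 2 : ℝ) =
        d * (∫ x, ‖w x‖ ^ 2) ^ (1 / 2 : ℝ) := by
      simp only [mul_pow]
      rw [integral_const_mul, mul_rpow (by positivity) (integral_nonneg fun x ↦ by positivity),
        ← sqrt_eq_rpow, sqrt_sq (by positivity)]
    have hH := hardy_inequality volume hE hv hvs
    rw [finrank_euclideanSpace_fin] at hH
    rw [hscale] at hJ
    have hW : 0 ≤ (∫ x, ‖w x‖ ^ 2) ^ (1 / 2 : ℝ) :=
      rpow_nonneg (integral_nonneg fun x ↦ by positivity) _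
    calc _ ≤ _ := norm_sub_le _ _
      _ ≤ _ := add_le_add ((norm_neg _).trans_le hI)
        (hJ.trans (mul_le_mul_of_nonneg_left hH (by positivity)))
      _ = _ := by ring
  · have hc : 1 + 2 * (d : ℝ) / (d - 2) ≤ 7 := by
      rw [← le_sub_iff_add_le', div_le_iff₀ hd2]; linarith
    have hW : 0 ≤ (∫ x, ‖w x‖ ^ 2) ^ (1 / 2 : ℝ) :=
      rpow_nonneg (integral_nonneg fun x ↦ by positivity) _
    have hV : 0 ≤ (∫ x, ‖fderiv ℝ v x‖ ^ 2) ^ (1 / 2 : ℝ) :=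
      rpow_nonneg (integral_nonneg fun x ↦ by positivity) _
    gcongr
end
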